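/- Let P, X be n×n complex matrices with P unitary, let B be an n×n complex matrix, and let ψ ∈ ℂⁿ be such that P·ψ = c·ψ for some c ∈ ℂ with |c| = 1. If P·B·P† = −B then ⟨ψ, B·ψ⟩ = 0; if moreover P·X·P† = −X, then ⟨ψ, X·B·X·ψ⟩ = 0 and consequently, for W = (1/√2)·(1 − i·X) with X† = X and X² = 1, one has ⟨W·ψ, B·(W·ψ)⟩ = (i/2)·⟨ψ, (X·B − B·X)·ψ⟩. -/

import Mathlib

open Matrix

/-- The standard Hermitian inner product on `ℂⁿ`, conjugate-linear in the first argument. -/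
noncomputable def cinner {n : ℕ} (x y : Fin n → ℂ) : ℂ :=
  ∑ i, starRingEnd ℂ (x i) * y i

theorem cinner_eq_dot {n : ℕ} (x y : Fin n → ℂ) : cinner x y = star x ⬝ᵥ y := rfl

theorem cinner_mulVec_left {n : ℕ} (A : Matrix (Fin n) (Fin n) ℂ) (x y : Fin n → ℂ) :
    cinner (A.mulVec x) y = cinner x (Aᴴ.mulVec y) := by
  rw [cinner_eq_dot, cinner_eq_dot, star_mulVec, dotProduct_mulVec]

theorem cinner_odd {n : ℕ} (P M : Matrix (Fin n) (Fin n) ℂ)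
    (hP : Pᴴ * P = 1) (ψ : Fin n → ℂ) (c : ℂ) (hc : ‖c‖ = 1)
    (hψ : P.mulVec ψ = c • ψ) (hM : P * M * Pᴴ = -M) :
    cinner ψ (M.mulVec ψ) = 0 := by
  have h1 : M * P = -(P * M) := by
    have : P * M * Pᴴ * P = -M * P := by rw [hM]
    rw [Matrix.mul_assoc, hP, Matrix.mul_one, Matrix.neg_mul] at this
    rw [this, neg_neg]
  have h2 : cinner (P.mulVec ψ) (M.mulVec (P.mulVec ψ)) = -cinner ψ (M.mulVec ψ) := by
    rw [cinner_mulVec_left, mulVec_mulVec, mulVec_mulVec, Matrix.mul_assoc, h1, Matrix.mul_neg,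
      ← Matrix.mul_assoc, hP, Matrix.one_mul, neg_mulVec, cinner_eq_dot, cinner_eq_dot,
      dotProduct_neg]
  have h3 : cinner (P.mulVec ψ) (M.mulVec (P.mulVec ψ)) = cinner ψ (M.mulVec ψ) := by
    have hcc : star c * c = 1 := by
      have := Complex.conj_mul' c
      rw [hc] at this
      simpa using this
    rw [hψ, cinner_eq_dot, cinner_eq_dot, mulVec_smul, star_smul, smul_dotProduct,
      dotProduct_smul, smul_smul, hcc, one_smul]
  rw [h3] at h2
  exact self_eq_neg.mp h2

/-- Symmetry argument for the Ramsey protocol: let `P` be unitary with `P·ψ = c·ψ`, `|c| = 1`.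
If `P·B·P† = −B` then `⟨ψ, B·ψ⟩ = 0`; if moreover `P·X·P† = −X`, then `⟨ψ, XBX·ψ⟩ = 0` and,
for the pulse `W = (1 − i·X)/√2` with `X† = X`, `X² = 1`, the Ramsey signal equals the
retarded Green's function: `⟨Wψ, B·(Wψ)⟩ = (i/2)·⟨ψ, (XB − BX)·ψ⟩`. -/
theorem ramsey_symmetry_argument {n : ℕ} (P X B : Matrix (Fin n) (Fin n) ℂ)
    (hP : Pᴴ * P = 1) (ψ : Fin n → ℂ) (c : ℂ) (hc : ‖c‖ = 1)
    (hψ : P.mulVec ψ = c • ψ) (hB : P * B * Pᴴ = -B) :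
    cinner ψ (B.mulVec ψ) = 0 ∧
    (P * X * Pᴴ = -X →
      cinner ψ ((X * B * X).mulVec ψ) = 0 ∧
      (Xᴴ = X → X * X = 1 →
        cinner ((((Real.sqrt 2 : ℂ))⁻¹ • (1 - Complex.I • X)).mulVec ψ)
            (B.mulVec ((((Real.sqrt 2 : ℂ))⁻¹ • (1 - Complex.I • X)).mulVec ψ)) =
          (Complex.I / 2) * cinner ψ ((X * B - B * X).mulVec ψ))) := by
  refine ⟨cinner_odd P B hP ψ c hc hψ hB, fun hX => ?_⟩
  have hPP : P * Pᴴ = 1 := mul_eq_one_comm.mp hP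
  have hXBX : P * (X * B * X) * Pᴴ = -(X * B * X) := by
    have : P * (X * B * X) * Pᴴ = (P * X * Pᴴ) * (P * B * Pᴴ) * (P * X * Pᴴ) := by
      calc P * (X * B * X) * Pᴴ = P * X * 1 * B * 1 * X * Pᴴ := by
            simp only [Matrix.mul_assoc, Matrix.one_mul]
        _ = _ := by rw [← hP]; simp only [Matrix.mul_assoc]
    rw [this, hX, hB]
    simp
  have h0 := cinner_odd P B hP ψ c hc hψ hB
  have h1 := cinner_odd P (X * B * X) hP ψ c hc hψ hXBX
  refine ⟨h1, fun hXh _ => ?_⟩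
  have hs : ((Real.sqrt 2 : ℂ))⁻¹ * ((Real.sqrt 2 : ℂ))⁻¹ = 1 / 2 := by
    rw [← mul_inv, ← Complex.ofReal_mul, Real.mul_self_sqrt (by norm_num)]
    norm_num
  have hW : (((Real.sqrt 2 : ℂ))⁻¹ • (1 - Complex.I • X))ᴴ =
      ((Real.sqrt 2 : ℂ))⁻¹ • (1 + Complex.I • X) := by
    simp [conjTranspose_smul, hXh]
  have hM : (((Real.sqrt 2 : ℂ))⁻¹ • (1 + Complex.I • X)) *
      (B * (((Real.sqrt 2 : ℂ))⁻¹ • (1 - Complex.I • X))) =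
      (1 / 2 : ℂ) • (B + X * B * X) + (Complex.I / 2) • (X * B - B * X) := by
    rw [Matrix.mul_smul, Matrix.smul_mul, Matrix.mul_smul, smul_smul, hs]
    have : (1 + Complex.I • X) * (B * (1 - Complex.I • X)) =
        (B + X * B * X) + Complex.I • (X * B - B * X) := by
      simp only [Matrix.add_mul, Matrix.mul_sub, Matrix.one_mul, Matrix.mul_one,
        Matrix.mul_smul, Matrix.smul_mul, smul_smul, Matrix.mul_assoc, smul_sub, smul_add,
        Complex.I_mul_I, neg_smul, one_smul]
      abel
    rw [this, smul_add, smul_smul]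
    congr 2
    ring
  rw [cinner_mulVec_left, mulVec_mulVec, mulVec_mulVec, hW, Matrix.mul_assoc, hM]
  rw [cinner_eq_dot] at h0 h1 ⊢
  rw [cinner_eq_dot, add_mulVec, smul_mulVec, smul_mulVec, add_mulVec, dotProduct_add,
    dotProduct_smul, dotProduct_smul, dotProduct_add, h0, h1]
  simp
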